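/- Let P ≥ 2 and 2 ≤ R ≤ P, and suppose C₁, C₂ > 0 satisfy ∫₀¹ |h(α;P,R)|¹⁰ dα ≤ C₁·P^{6+Δ₁₀} and ∫₀¹ |h(α;P,R)|¹² dα ≤ C₂·P^{8}. Let T ≥ 1, let 𝒵 = {n ∈ ℤ : |n| ≤ P⁹ and T < |ψ(n)| ≤ 2T}, let Z = card(𝒵), let ω_n = 1 if ψ(n) > 0 and ω_n = −1 if ψ(n) < 0, and put K(α) = Σ_{n∈𝒵} ω_n e(−nα). Suppose further that ε > 0 and C₃ > 0 satisfy ∫₀¹ |h(α;P,R)⁴ K(α)²| dα ≤ C₃·(P³Z + P^{2+ε}Z^{3/2}). Then Z ≤ C·( P^{28/3 + Δ₁₀/3}·T^{−2} + P^{13 + Δ₁₀/2 + ε}·T^{−3} ) for a constant C depending at most on C₁, C₂, C₃ and ε. -/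

import Mathlib

open scoped Real
open Filter MeasureTheory

noncomputable section

/-- `e(z) = exp(2πiz)`. -/
def e (z : ℝ) : ℂ := Complex.exp (2 * Real.pi * Complex.I * z)

/-- The set `𝒜(P,R)` of `R`-smooth positive integers not exceeding `P`. -/
def smoothA (P R : ℝ) : Finset ℕ :=
  (Finset.Icc 1 ⌊P⌋₊).filter (fun n => ∀ p ∈ n.primeFactors, (p : ℝ) ≤ R)

/-- The smooth Weyl sum `h(α; P, R)`. -/
def h (P R α : ℝ) : ℂ := ∑ x ∈ smoothA P R, e (α * (x : ℝ) ^ 4)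

/-- `Δ₇ = 0.849408`. -/
def Δ₇ : ℝ := 0.849408

/-- `Δ₁₀ = 0.213431`. -/
def Δ₁₀ : ℝ := 0.213431

/-- The Fourier coefficient `ψ(n) = ∫₀¹ |h(α)|⁷ e(-nα) dα`. -/
def ψ (P R : ℝ) (n : ℤ) : ℂ :=
  ∫ α in (0:ℝ)..1, (‖h P R α‖ : ℂ) ^ 7 * e (-(n : ℝ) * α)

/-- The set `𝒵 = {n ∈ ℤ : |n| ≤ P⁹, T < |ψ(n)| ≤ 2T}`. -/
def Zset (P R T : ℝ) : Finset ℤ :=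
  (Finset.Icc (-⌊P ^ 9⌋) ⌊P ^ 9⌋).filter
    (fun n => T < ‖ψ P R n‖ ∧ ‖ψ P R n‖ ≤ 2 * T)

/-- The exponential sum `K(α) = Σ_{n∈𝒵} ω_n e(-nα)`, where `ω_n = sgn ψ(n)`. -/
def K (P R T : ℝ) (α : ℝ) : ℂ :=
  ∑ n ∈ Zset P R T, (if 0 < (ψ P R n).re then (1 : ℂ) else -1) * e (-(n : ℝ) * α)

lemma e_add (x y : ℝ) : e (x + y) = e x * e y := by
  simp only [e, ← Complex.exp_add]
  congr 1
  push_cast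
  ring

lemma e_int (n : ℤ) : e n = 1 := by
  rw [e, Complex.exp_eq_one_iff]
  exact ⟨n, by push_cast; ring⟩

lemma conj_e (x : ℝ) : (starRingEnd ℂ) (e x) = e (-x) := by
  simp only [e, ← Complex.exp_conj]
  congr 1
  simp [Complex.conj_ofNat]

lemma continuous_e : Continuous e := by
  unfold e
  fun_prop

lemma continuous_h (P R : ℝ) : Continuous (h P R) := by
  unfold h
  exact continuous_finsetSum _ fun x _ => continuous_e.comp (by fun_prop)

lemma continuous_K (P R T : ℝ) : Continuous (K P R T) := by
  unfold K
  exact continuous_finsetSum _ fun n _ =>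
    continuous_const.mul (continuous_e.comp (by fun_prop))

lemma continuous_ψ_integrand (P R : ℝ) (n : ℤ) :
    Continuous fun α : ℝ => (‖h P R α‖ : ℂ) ^ 7 * e (-(n : ℝ) * α) :=
  ((Complex.continuous_ofReal.comp (continuous_h P R).norm).pow 7).mul
    (continuous_e.comp (by fun_prop))

lemma norm_h_one_sub (P R α : ℝ) : ‖h P R (1 - α)‖ = ‖h P R α‖ := by
  have hconj : h P R (1 - α) = (starRingEnd ℂ) (h P R α) := by
    simp only [h, map_sum, conj_e]
    refine Finset.sum_congr rfl fun x _ => ?_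
    rw [show (1 - α) * (x : ℝ) ^ 4 = (((x : ℤ) ^ 4 : ℤ) : ℝ) + -(α * (x : ℝ) ^ 4) by
      push_cast; ring, e_add, e_int, one_mul]
  rw [hconj, RCLike.norm_conj]

/-- The Fourier coefficients `ψ(n)` are real, as `|h|` is even and has period `1`. -/
lemma conj_ψ (P R : ℝ) (n : ℤ) : (starRingEnd ℂ) (ψ P R n) = ψ P R n := by
  have hsub := intervalIntegral.integral_comp_sub_left (a := (0 : ℝ)) (b := 1)
    (fun α : ℝ => (‖h P R α‖ : ℂ) ^ 7 * e (-(n : ℝ) * α)) 1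
  rw [sub_self, sub_zero] at hsub
  rw [ψ, intervalIntegral.integral_of_le zero_le_one, ← integral_conj,
    ← intervalIntegral.integral_of_le zero_le_one, ← intervalIntegral.integral_of_le zero_le_one,
    ← hsub]
  refine intervalIntegral.integral_congr fun α _ => ?_
  simp only [map_mul, map_pow, Complex.conj_ofReal, conj_e, norm_h_one_sub]
  rw [show -(n : ℝ) * (1 - α) = ((-n : ℤ) : ℝ) + -(-(n : ℝ) * α) by push_cast; ring,
    e_add, e_int, one_mul]

lemma sign_mul_ψ (P R : ℝ) (n : ℤ) :
    (if 0 < (ψ P R n).re then (1 : ℂ) else -1) * ψ P R n = (‖ψ P R n‖ : ℂ) := by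
  obtain ⟨r, hr⟩ := Complex.conj_eq_iff_real.mp (conj_ψ P R n)
  rw [hr, Complex.ofReal_re, Complex.norm_real, Real.norm_eq_abs]
  split_ifs with hpos
  · rw [abs_of_pos hpos, one_mul]
  · rw [abs_of_nonpos (not_lt.mp hpos)]
    push_cast
    ring

lemma integral_e_int (m : ℤ) : ∫ α in (0 : ℝ)..1, e (m * α) = if m = 0 then 1 else 0 := by
  split_ifs with hm
  · simp [hm, e]
  · have hc : (2 * Real.pi * Complex.I * m : ℂ) ≠ 0 := by
      simp [Real.pi_ne_zero, Complex.I_ne_zero, hm]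
    have hform : ∀ α : ℝ, e (m * α) = Complex.exp ((2 * Real.pi * Complex.I * m) * α) := by
      intro α
      rw [e]
      congr 1
      push_cast
      ring
    simp only [hform]
    rw [integral_exp_mul_complex hc]
    have h1 := e_int m
    rw [e] at h1
    push_cast at h1
    simp [h1]

/-- Parseval's identity for `K`, whose coefficients are all of modulus `1`. -/
lemma integral_norm_K_sq (P R T : ℝ) :
    ∫ α in (0 : ℝ)..1, ‖K P R T α‖ ^ 2 = (Zset P R T).card := by
  set ω : ℤ → ℂ := fun n => if 0 < (ψ P R n).re then (1 : ℂ) else -1 with hω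
  have hωsq : ∀ n, ω n * (starRingEnd ℂ) (ω n) = 1 := by
    intro n
    simp only [hω]
    split_ifs <;> simp
  have hexp : ∀ α : ℝ, ((‖K P R T α‖ ^ 2 : ℝ) : ℂ) =
      ∑ n ∈ Zset P R T, ∑ m ∈ Zset P R T,
        ω n * (starRingEnd ℂ) (ω m) * e (((m - n : ℤ) : ℝ) * α) := by
    intro α
    rw [Complex.ofReal_pow, ← Complex.mul_conj', K, map_sum, Finset.sum_mul_sum]
    refine Finset.sum_congr rfl fun n _ => Finset.sum_congr rfl fun m _ => ?_
    rw [map_mul, conj_e, show ((m - n : ℤ) : ℝ) * α = -(n : ℝ) * α + -(-(m : ℝ) * α) by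
      push_cast; ring, e_add]
    ring
  have hcont : ∀ n m : ℤ, Continuous fun α : ℝ =>
      ω n * (starRingEnd ℂ) (ω m) * e (((m - n : ℤ) : ℝ) * α) := fun n m =>
    continuous_const.mul (continuous_e.comp (by fun_prop))
  apply Complex.ofReal_injective
  rw [← intervalIntegral.integral_ofReal]
  simp only [hexp]
  rw [intervalIntegral.integral_finsetSum fun n _ =>
    (continuous_finsetSum _ fun m _ => hcont n m).intervalIntegrable _ _]
  have hinner : ∀ n ∈ Zset P R T, (∫ α in (0 : ℝ)..1, ∑ m ∈ Zset P R T,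
      ω n * (starRingEnd ℂ) (ω m) * e (((m - n : ℤ) : ℝ) * α)) = 1 := by
    intro n hn
    rw [intervalIntegral.integral_finsetSum fun m _ => (hcont n m).intervalIntegrable _ _]
    simp only [intervalIntegral.integral_const_mul, integral_e_int, sub_eq_zero, mul_ite,
      mul_one, mul_zero]
    rw [Finset.sum_ite_eq', if_pos hn, hωsq]
  rw [Finset.sum_congr rfl hinner]
  simp

lemma mul_card_Zset_le (P R T : ℝ) :
    T * (Zset P R T).card ≤ ∫ α in (0 : ℝ)..1, ‖h P R α‖ ^ 7 * ‖K P R T α‖ := by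
  have hsum : ∫ α in (0 : ℝ)..1, (‖h P R α‖ : ℂ) ^ 7 * K P R T α =
      ((∑ n ∈ Zset P R T, ‖ψ P R n‖ : ℝ) : ℂ) := by
    simp only [K, Finset.mul_sum, mul_left_comm ((‖h P R _‖ : ℂ) ^ 7)]
    rw [intervalIntegral.integral_finsetSum fun n _ =>
      ((continuous_ψ_integrand P R n).intervalIntegrable _ _).const_mul _]
    simp only [intervalIntegral.integral_const_mul]
    push_cast
    exact Finset.sum_congr rfl fun n _ => sign_mul_ψ P R n
  have hlow : T * (Zset P R T).card ≤ ∑ n ∈ Zset P R T, ‖ψ P R n‖ := by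
    rw [mul_comm, ← nsmul_eq_mul]
    exact Finset.card_nsmul_le_sum _ _ _ fun n hn => (Finset.mem_filter.mp hn).2.1.le
  refine hlow.trans ?_
  calc ∑ n ∈ Zset P R T, ‖ψ P R n‖
      ≤ ‖((∑ n ∈ Zset P R T, ‖ψ P R n‖ : ℝ) : ℂ)‖ := by
        rw [Complex.norm_real]
        exact Real.le_norm_self _
    _ ≤ ∫ α in (0 : ℝ)..1, ‖(‖h P R α‖ : ℂ) ^ 7 * K P R T α‖ := by
        rw [← hsum]
        exact intervalIntegral.norm_integral_le_integral_norm zero_le_one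
    _ = ∫ α in (0 : ℝ)..1, ‖h P R α‖ ^ 7 * ‖K P R T α‖ := by
        simp

/-- Hölder's inequality with exponents `3, 6, 6, 3`, for continuous functions. -/
lemma integral_pow_mul_pow_six_le {u v : ℝ → ℝ} (hu : Continuous u) (hv : Continuous v)
    (hu0 : ∀ x, 0 ≤ u x) (hv0 : ∀ x, 0 ≤ v x) :
    (∫ x in (0 : ℝ)..1, u x ^ 7 * v x) ^ 6 ≤
      (∫ x in (0 : ℝ)..1, u x ^ 4 * v x ^ 2) ^ 2 * (∫ x in (0 : ℝ)..1, v x ^ 2) *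
        (∫ x in (0 : ℝ)..1, u x ^ 10) * (∫ x in (0 : ℝ)..1, u x ^ 12) ^ 2 := by
  set μ : Measure ℝ := volume.restrict (Set.Ioc 0 1) with hμ
  have key : ∀ f : ℝ → ℝ, Continuous f → (∀ x, 0 ≤ f x) →
      ENNReal.ofReal (∫ x in (0 : ℝ)..1, f x) = ∫⁻ x, ENNReal.ofReal (f x) ∂μ := by
    intro f hf hf0
    rw [intervalIntegral.integral_of_le zero_le_one]
    exact ofReal_integral_eq_lintegral_ofReal
      ((intervalIntegrable_iff_integrableOn_Ioc_of_le zero_le_one).mp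
        (hf.intervalIntegrable 0 1)) (Eventually.of_forall hf0)
  have nonneg : ∀ f : ℝ → ℝ, (∀ x, 0 ≤ f x) → 0 ≤ ∫ x in (0 : ℝ)..1, f x := fun f hf =>
    intervalIntegral.integral_nonneg zero_le_one fun x _ => hf x
  set F : Fin 4 → ℝ → ℝ := ![fun x => u x ^ 4 * v x ^ 2, fun x => v x ^ 2,
    fun x => u x ^ 10, fun x => u x ^ 12] with hF
  set p : Fin 4 → ℝ := ![1 / 3, 1 / 6, 1 / 6, 1 / 3] with hp
  have hFc : ∀ i, Continuous (F i) := by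
    intro i
    fin_cases i <;> simp [hF] <;> fun_prop
  have hF0 : ∀ i x, 0 ≤ F i x := by
    intro i x
    have := hu0 x
    have := hv0 x
    fin_cases i <;> simp [hF] <;> positivity
  have hp0 : ∀ i, 0 ≤ p i := by
    intro i
    fin_cases i <;> norm_num [hp]
  have hpt : ∀ x, ∏ i, F i x ^ p i = u x ^ 7 * v x := by
    intro x
    have hux := hu0 x
    have hvx := hv0 x
    simp only [Fin.prod_univ_four, hF, hp, Matrix.cons_val]
    refine (pow_left_inj₀ (by positivity) (by positivity) (n := 6) (by norm_num)).mp ?_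
    simp only [mul_pow, ← Real.rpow_mul_natCast (by positivity : 0 ≤ u x ^ 4 * v x ^ 2),
      ← Real.rpow_mul_natCast (by positivity : 0 ≤ v x ^ 2),
      ← Real.rpow_mul_natCast (by positivity : 0 ≤ u x ^ 10),
      ← Real.rpow_mul_natCast (by positivity : 0 ≤ u x ^ 12)]
    norm_num
    ring
  have holder := ENNReal.lintegral_prod_norm_pow_le (μ := μ) Finset.univ
    (f := fun i x => ENNReal.ofReal (F i x)) (p := p)
    (fun i _ => (hFc i).measurable.ennreal_ofReal.aemeasurable)
    (by simp [Fin.sum_univ_four, hp]; norm_num) (fun i _ => hp0 i)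
  have hprod : ∀ a : Fin 4 → ℝ, (∀ i, 0 ≤ a i) →
      ∏ i, ENNReal.ofReal (a i) ^ p i = ENNReal.ofReal (∏ i, a i ^ p i) := by
    intro a ha
    rw [ENNReal.ofReal_prod_of_nonneg fun i _ => Real.rpow_nonneg (ha i) _]
    exact Finset.prod_congr rfl fun i _ => ENNReal.ofReal_rpow_of_nonneg (ha i) (hp0 i)
  simp only [← key _ (hFc _) (hF0 _)] at holder
  rw [hprod _ fun i => nonneg _ (hF0 i)] at holder
  simp only [fun x => hprod (fun i => F i x) fun i => hF0 i x, hpt] at holder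
  have hG0 : ∀ x, 0 ≤ u x ^ 7 * v x := fun x => mul_nonneg (pow_nonneg (hu0 x) 7) (hv0 x)
  rw [← key _ (by fun_prop) hG0, ENNReal.ofReal_le_ofReal_iff
    (Finset.prod_nonneg fun i _ => Real.rpow_nonneg (nonneg _ (hF0 i)) _)] at holder
  refine (pow_le_pow_left₀ (nonneg _ hG0) holder 6).trans_eq ?_
  have n0 := nonneg _ (hF0 0)
  have n1 := nonneg _ (hF0 1)
  have n2 := nonneg _ (hF0 2)
  have n3 := nonneg _ (hF0 3)
  simp only [Fin.prod_univ_four, mul_pow, ← Real.rpow_mul_natCast n0,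
    ← Real.rpow_mul_natCast n1, ← Real.rpow_mul_natCast n2, ← Real.rpow_mul_natCast n3]
  simp only [hF, hp, Matrix.cons_val]
  norm_num

/-- The bound for `Z` that follows from the Hölder estimate
`(TZ)⁶ ≤ I² Z M₁₀ M₁₂²` and the bounds for the three moments. -/
lemma le_of_moment_bounds {ε δ C₁ C₂ C₃ P T Z I M₁₀ M₁₂ : ℝ} (hC₁ : 0 < C₁) (hC₂ : 0 < C₂)
    (hC₃ : 0 < C₃) (hP : 0 < P) (hT : 0 < T) (hZ : 0 < Z) (hI0 : 0 ≤ I) (hM₁₀_nonneg : 0 ≤ M₁₀)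
    (hM₁₂_nonneg : 0 ≤ M₁₂) (hM₁₀ : M₁₀ ≤ C₁ * P ^ ((6 : ℝ) + δ)) (hM₁₂ : M₁₂ ≤ C₂ * P ^ (8 : ℝ))
    (hI : I ≤ C₃ * (P ^ 3 * Z + P ^ ((2 : ℝ) + ε) * Z ^ ((3 : ℝ) / 2)))
    (hmain : (T * Z) ^ 6 ≤ I ^ 2 * Z * M₁₀ * M₁₂ ^ 2) :
    Z ≤ (1 + 4 * C₃ ^ 2 * C₁ * C₂ ^ 2) *
      (P ^ ((28 : ℝ) / 3 + δ / 3) / T ^ 2 + P ^ (13 + δ / 2 + ε) / T ^ 3) := by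
  set D := 1 + 4 * C₃ ^ 2 * C₁ * C₂ ^ 2 with hD
  have hD1 : 1 ≤ D := by
    have : 0 ≤ 4 * C₃ ^ 2 * C₁ * C₂ ^ 2 := by positivity
    linarith
  set X := P ^ ((28 : ℝ) / 3 + δ / 3) / T ^ 2 with hX
  set Y := P ^ (13 + δ / 2 + ε) / T ^ 3 with hY
  have hX0 : 0 < X := by positivity
  have hY0 : 0 < Y := by positivity
  have hM : M₁₀ * M₁₂ ^ 2 ≤ C₁ * C₂ ^ 2 * P ^ ((22 : ℝ) + δ) := by
    calc M₁₀ * M₁₂ ^ 2 ≤ (C₁ * P ^ ((6 : ℝ) + δ)) * (C₂ * P ^ (8 : ℝ)) ^ 2 := by gcongr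
      _ = C₁ * C₂ ^ 2 * (P ^ ((6 : ℝ) + δ) * (P ^ (8 : ℝ)) ^ 2) := by ring
      _ = _ := by
        rw [← Real.rpow_mul_natCast hP.le, ← Real.rpow_add hP]
        norm_num
        left
        ring_nf
  have hbound : ∀ J : ℝ, I ≤ C₃ * (2 * J) → 0 ≤ J →
      T ^ 6 * Z ^ 5 ≤ D * (J ^ 2 * P ^ ((22 : ℝ) + δ)) := by
    intro J hIJ hJ0
    have hDJ : 4 * C₃ ^ 2 * C₁ * C₂ ^ 2 * (J ^ 2 * P ^ ((22 : ℝ) + δ)) ≤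
        D * (J ^ 2 * P ^ ((22 : ℝ) + δ)) := by
      gcongr
      linarith
    refine le_trans (le_of_mul_le_mul_left ?_ hZ) hDJ
    calc Z * (T ^ 6 * Z ^ 5) = (T * Z) ^ 6 := by ring
      _ ≤ I ^ 2 * Z * M₁₀ * M₁₂ ^ 2 := hmain
      _ = Z * (I ^ 2 * (M₁₀ * M₁₂ ^ 2)) := by ring
      _ ≤ Z * ((C₃ * (2 * J)) ^ 2 * (C₁ * C₂ ^ 2 * P ^ ((22 : ℝ) + δ))) := by gcongr
      _ = _ := by ring
  rcases le_total (P ^ ((2 : ℝ) + ε) * Z ^ ((3 : ℝ) / 2)) (P ^ 3 * Z) with hle | hle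
  · have hb := hbound (P ^ 3 * Z) (hI.trans (by gcongr; linarith)) (by positivity)
    have hcube : Z ^ 3 ≤ (D * X) ^ 3 := by
      have hXc : X ^ 3 = P ^ 6 * P ^ ((22 : ℝ) + δ) / T ^ 6 := by
        rw [hX, div_pow, ← Real.rpow_mul_natCast hP.le, ← Real.rpow_natCast P 6,
          ← Real.rpow_add hP]
        ring_nf
      have hstep : Z ^ 3 ≤ D * X ^ 3 := by
        rw [hXc, ← mul_div_assoc, le_div_iff₀ (by positivity)]
        refine le_of_mul_le_mul_left ?_ (by positivity : 0 < Z ^ 2)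
        linarith
      rw [mul_pow]
      refine hstep.trans ?_
      gcongr
      exact le_self_pow₀ hD1 (by norm_num)
    have := le_of_pow_le_pow_left₀ (by norm_num) (by positivity) hcube
    nlinarith
  · have hb := hbound (P ^ ((2 : ℝ) + ε) * Z ^ ((3 : ℝ) / 2)) (hI.trans (by gcongr; linarith))
      (by positivity)
    have hsq : Z ^ 2 ≤ (D * Y) ^ 2 := by
      have hYc : Y ^ 2 = (P ^ ((2 : ℝ) + ε)) ^ 2 * P ^ ((22 : ℝ) + δ) / T ^ 6 := by
        rw [hY, div_pow, ← Real.rpow_mul_natCast hP.le, ← Real.rpow_mul_natCast hP.le,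
          ← Real.rpow_add hP]
        push_cast
        ring_nf
      have hZ3 : (Z ^ ((3 : ℝ) / 2)) ^ 2 = Z ^ 3 := by
        rw [← Real.rpow_mul_natCast hZ.le]
        norm_num
      have hstep : Z ^ 2 ≤ D * Y ^ 2 := by
        rw [hYc, ← mul_div_assoc, le_div_iff₀ (by positivity)]
        refine le_of_mul_le_mul_left ?_ (by positivity : 0 < Z ^ 3)
        rw [mul_pow, hZ3] at hb
        linarith
      rw [mul_pow]
      refine hstep.trans ?_
      gcongr
      exact le_self_pow₀ hD1 (by norm_num)
    have := le_of_pow_le_pow_left₀ (by norm_num) (by positivity) hsq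
    nlinarith

/-- first large-values estimate for `Z = card 𝒵`:
`Z ≪ P^{28/3 + Δ₁₀/3}·T⁻² + P^{13 + Δ₁₀/2 + ε}·T⁻³`. -/
theorem large_values_first_estimate
    (ε C₁ C₂ C₃ : ℝ) (hε : 0 < ε) (hC₁ : 0 < C₁) (hC₂ : 0 < C₂) (hC₃ : 0 < C₃) :
    ∃ C : ℝ, ∀ P R T : ℝ, 2 ≤ P → 2 ≤ R → R ≤ P → 1 ≤ T →
      (∫ α in (0:ℝ)..1, ‖h P R α‖ ^ 10) ≤ C₁ * P ^ ((6:ℝ) + Δ₁₀) →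
      (∫ α in (0:ℝ)..1, ‖h P R α‖ ^ 12) ≤ C₂ * P ^ (8:ℝ) →
      (∫ α in (0:ℝ)..1, ‖(h P R α) ^ 4 * (K P R T α) ^ 2‖) ≤
          C₃ * (P ^ 3 * ((Zset P R T).card : ℝ) +
            P ^ ((2:ℝ) + ε) * ((Zset P R T).card : ℝ) ^ ((3:ℝ)/2)) →
      ((Zset P R T).card : ℝ) ≤
        C * (P ^ ((28:ℝ)/3 + Δ₁₀/3) / T ^ 2 + P ^ (13 + Δ₁₀/2 + ε) / T ^ 3) := by
  refine ⟨1 + 4 * C₃ ^ 2 * C₁ * C₂ ^ 2, fun P R T hP _ _ hT hM₁₀ hM₁₂ hI => ?_⟩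
  have hP0 : 0 < P := by linarith
  have hT0 : 0 < T := by linarith
  rcases Nat.eq_zero_or_pos (Zset P R T).card with hZ | hZ
  · rw [hZ, Nat.cast_zero]
    positivity
  have holder := integral_pow_mul_pow_six_le (continuous_h P R).norm (continuous_K P R T).norm
    (fun _ => norm_nonneg _) (fun _ => norm_nonneg _)
  rw [integral_norm_K_sq] at holder
  simp only [norm_mul, norm_pow] at hI
  have nonneg : ∀ f : ℝ → ℝ, (∀ x, 0 ≤ f x) → 0 ≤ ∫ x in (0 : ℝ)..1, f x := fun f hf =>
    intervalIntegral.integral_nonneg zero_le_one fun x _ => hf x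
  exact le_of_moment_bounds hC₁ hC₂ hC₃ hP0 hT0 (Nat.cast_pos.mpr hZ)
    (nonneg _ fun _ => by positivity) (nonneg _ fun _ => by positivity)
    (nonneg _ fun _ => by positivity) hM₁₀ hM₁₂ hI
    ((pow_le_pow_left₀ (by positivity) (mul_card_Zset_le P R T) 6).trans holder)
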